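/- arXiv:1904.11188 — 2 statements merged into one kernel-verified Lean document; each statement's English description precedes it below -/
import Mathlib

section
/- The quantity F(λ) − f_λ(p^{t+1}, p^t) is non-increasing in t along the Blahut–Arimoto iteration; equivalently, f_λ(p^{t+1}, p^t) ≥ f_λ(p^t, p^{t-1}) for all t ≥ 1, since f_λ(p^{t+1}, p^t) ≥ f_λ(p^t, p^t) ≥ f_λ(p^t, p^{t-1}). -/
open Matrix Finset Filter ComplexOrder

/-- Matrix logarithm on the support: for a Hermitian matrix, apply `Real.log`
to the eigenvalues (note `Real.log 0 = 0`, giving the logarithm on the support);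
junk value `0` otherwise. -/
noncomputable def mlog {k : ℕ} (A : Matrix (Fin k) (Fin k) ℂ) : Matrix (Fin k) (Fin k) ℂ :=
  if h : A.IsHermitian then
    (h.eigenvectorUnitary : Matrix (Fin k) (Fin k) ℂ) *
      Matrix.diagonal (fun i => (Real.log (h.eigenvalues i) : ℂ)) *
      (star (h.eigenvectorUnitary : Matrix (Fin k) (Fin k) ℂ))
  else 0

/-- A density matrix: positive semidefinite with unit trace. -/
def IsDensity {k : ℕ} (ρ : Matrix (Fin k) (Fin k) ℂ) : Prop :=
  ρ.PosSemidef ∧ ρ.trace = 1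

/-- A probability distribution on `Fin k`. -/
def IsDist {k : ℕ} (p : Fin k → ℝ) : Prop :=
  (∀ x, 0 ≤ p x) ∧ ∑ x, p x = 1

/-- `supp ρ ⊆ supp σ`, expressed as `ker σ ⊆ ker ρ`. -/
def SuppLE {k : ℕ} (ρ σ : Matrix (Fin k) (Fin k) ℂ) : Prop :=
  ∀ v, σ.mulVec v = 0 → ρ.mulVec v = 0

/-- Quantum relative entropy `D(ρ‖σ) = Tr[ρ(log ρ − log σ)]` (natural log). -/
noncomputable def qRelEnt {k : ℕ} (ρ σ : Matrix (Fin k) (Fin k) ℂ) : ℝ :=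
  (Matrix.trace (ρ * (mlog ρ - mlog σ))).re

/-- Von Neumann entropy `H(ρ) = −Tr(ρ log ρ)` (natural log). -/
noncomputable def vN {k : ℕ} (ρ : Matrix (Fin k) (Fin k) ℂ) : ℝ :=
  -(Matrix.trace (ρ * mlog ρ)).re

/-- Classical relative entropy `D(p‖q)`. -/
noncomputable def cRelEnt {k : ℕ} (p q : Fin k → ℝ) : ℝ :=
  ∑ x, p x * (Real.log (p x) - Real.log (q x))

/-- Holevo quantity `χ(p) = H(Σ_x p_x ρ_x) − Σ_x p_x H(ρ_x)`. -/
noncomputable def holevo {n m : ℕ} (ρ : Fin n → Matrix (Fin m) (Fin m) ℂ)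
    (p : Fin n → ℝ) : ℝ :=
  vN (∑ x, (p x : ℂ) • ρ x) - ∑ x, p x * vN (ρ x)

/-- `f_λ(p, p') = Σ_x Tr{p_x ρ_x [log(p'_x ρ_x) − log(p_x ρ')]} − λ sᵀp`,
where `ρ' = Σ_x p'_x ρ_x`. -/
noncomputable def fBA {n m : ℕ} (ρ : Fin n → Matrix (Fin m) (Fin m) ℂ)
    (s : Fin n → ℝ) (lam : ℝ) (p p' : Fin n → ℝ) : ℝ :=
  (∑ x, (Matrix.trace (((p x : ℂ) • ρ x) *
      (mlog ((p' x : ℂ) • ρ x) - mlog ((p x : ℂ) • ∑ y, (p' y : ℂ) • ρ y)))).re)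
    - lam * ∑ x, s x * p x

/-- `r_x = exp(Tr{ρ_x[log(p_x ρ_x) − log ρ̄]} − λ s_x)` with `ρ̄ = Σ_y p_y ρ_y`. -/
noncomputable def rBA {n m : ℕ} (ρ : Fin n → Matrix (Fin m) (Fin m) ℂ)
    (s : Fin n → ℝ) (lam : ℝ) (p : Fin n → ℝ) (x : Fin n) : ℝ :=
  Real.exp ((Matrix.trace (ρ x *
      (mlog ((p x : ℂ) • ρ x) - mlog (∑ y, (p y : ℂ) • ρ y)))).re - lam * s x)

/-- One Blahut–Arimoto update step. -/
noncomputable def baStep {n m : ℕ} (ρ : Fin n → Matrix (Fin m) (Fin m) ℂ)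
    (s : Fin n → ℝ) (lam : ℝ) (p : Fin n → ℝ) (x : Fin n) : ℝ :=
  rBA ρ s lam p x / ∑ y, rBA ρ s lam p y

/-- The Blahut–Arimoto iterates starting from `p0`. -/
noncomputable def baSeq {n m : ℕ} (ρ : Fin n → Matrix (Fin m) (Fin m) ℂ)
    (s : Fin n → ℝ) (lam : ℝ) (p0 : Fin n → ℝ) : ℕ → Fin n → ℝ
  | 0 => p0
  | t + 1 => baStep ρ s lam (baSeq ρ s lam p0 t)

namespace Matrix

variable {k : ℕ}

/-- The squared overlaps `|⟨a_i, b_j⟩|²` of the eigenbases of two Hermitian matrices. -/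
noncomputable def IsHermitian.overlap {A B : Matrix (Fin k) (Fin k) ℂ}
    (hA : A.IsHermitian) (hB : B.IsHermitian) (i j : Fin k) : ℝ :=
  Complex.normSq ((star (hA.eigenvectorUnitary : Matrix (Fin k) (Fin k) ℂ) *
    (hB.eigenvectorUnitary : Matrix (Fin k) (Fin k) ℂ)) i j)

theorem IsHermitian.overlap_nonneg {A B : Matrix (Fin k) (Fin k) ℂ}
    (hA : A.IsHermitian) (hB : B.IsHermitian) (i j : Fin k) : 0 ≤ hA.overlap hB i j :=
  Complex.normSq_nonneg _

theorem IsHermitian.cfc_eq_mul_diagonal_mul {A : Matrix (Fin k) (Fin k) ℂ} (hA : A.IsHermitian)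
    (f : ℝ → ℝ) :
    cfc f A = (hA.eigenvectorUnitary : Matrix (Fin k) (Fin k) ℂ) *
      diagonal (fun i => (f (hA.eigenvalues i) : ℂ)) *
      star (hA.eigenvectorUnitary : Matrix (Fin k) (Fin k) ℂ) := by
  rw [hA.cfc_eq, IsHermitian.cfc, Unitary.conjStarAlgAut_apply]
  rfl

theorem IsHermitian.eq_mul_diagonal_mul {A : Matrix (Fin k) (Fin k) ℂ} (hA : A.IsHermitian) :
    A = (hA.eigenvectorUnitary : Matrix (Fin k) (Fin k) ℂ) *
      diagonal (fun i => (hA.eigenvalues i : ℂ)) *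
      star (hA.eigenvectorUnitary : Matrix (Fin k) (Fin k) ℂ) := by
  conv_lhs => rw [hA.spectral_theorem, Unitary.conjStarAlgAut_apply]
  rfl

theorem IsHermitian.mlog_eq_cfc {A : Matrix (Fin k) (Fin k) ℂ} (hA : A.IsHermitian) :
    mlog A = cfc Real.log A := by
  rw [mlog, dif_pos hA, hA.cfc_eq_mul_diagonal_mul]

theorem IsHermitian.mlog_smul_eq_cfc {A : Matrix (Fin k) (Fin k) ℂ} (hA : A.IsHermitian) (c : ℝ) :
    mlog ((c : ℂ) • A) = cfc (fun x => Real.log (c * x)) A := by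
  have hc : (c : ℂ) • A = c • A := by ext; simp
  have h : (c • A).IsHermitian := by
    rw [IsHermitian, conjTranspose_smul, hA.eq]; simp
  rw [hc, h.mlog_eq_cfc]
  rw [cfc_comp_const_mul c Real.log A
    ((Set.Finite.image _ Matrix.finite_real_spectrum).continuousOn _) hA.isSelfAdjoint]

/-- `Tr (D W E Wᴴ)` for real diagonal matrices `D` and `E`. -/
theorem re_trace_diagonal_mul_conj (W : Matrix (Fin k) (Fin k) ℂ) (d e : Fin k → ℝ) :
    (trace (diagonal (fun i => (d i : ℂ)) *
      (W * diagonal (fun j => (e j : ℂ)) * Wᴴ))).re =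
      ∑ i, ∑ j, Complex.normSq (W i j) * (d i * e j) := by
  simp only [trace, diag_apply, diagonal_mul, mul_apply (N := Wᴴ), mul_diagonal,
    conjTranspose_apply, Complex.re_sum, Finset.mul_sum, Complex.star_def]
  refine Finset.sum_congr rfl fun i _ => Finset.sum_congr rfl fun j _ => ?_
  simp [Complex.normSq_apply]
  ring

theorem IsHermitian.re_trace_cfc_mul_cfc {A B : Matrix (Fin k) (Fin k) ℂ}
    (hA : A.IsHermitian) (hB : B.IsHermitian) (f g : ℝ → ℝ) :
    (trace (cfc f A * cfc g B)).re =
      ∑ i, ∑ j, hA.overlap hB i j * (f (hA.eigenvalues i) * g (hB.eigenvalues j)) := by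
  rw [hA.cfc_eq_mul_diagonal_mul, hB.cfc_eq_mul_diagonal_mul]
  simp only [IsHermitian.overlap]
  rw [← re_trace_diagonal_mul_conj]
  simp only [mul_assoc]
  rw [trace_mul_comm]
  simp only [mul_assoc, star_eq_conjTranspose, conjTranspose_mul, conjTranspose_conjTranspose]

theorem PosSemidef.overlap_mul_eq_zero {A B : Matrix (Fin k) (Fin k) ℂ}
    (hA : A.PosSemidef) (hB : B.PosSemidef) {C : ℝ} (h : ((C : ℂ) • B - A).PosSemidef)
    {i j : Fin k} (hj : hB.1.eigenvalues j = 0) :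
    hA.1.overlap hB.1 i j * hA.1.eigenvalues i = 0 := by
  set U := (hA.1.eigenvectorUnitary : Matrix (Fin k) (Fin k) ℂ) with hU
  set V := (hB.1.eigenvectorUnitary : Matrix (Fin k) (Fin k) ℂ) with hV
  have hVV : star V * V = 1 := Unitary.coe_star_mul_self _
  have h1 : (star V * ((C : ℂ) • B - A) * V).PosSemidef := h.conjTranspose_mul_mul_same V
  have h2 : star V * B * V = diagonal (fun i => (hB.1.eigenvalues i : ℂ)) := by
    conv_lhs => rw [hB.1.eq_mul_diagonal_mul, ← hV]
    rw [mul_assoc, mul_assoc, mul_assoc, hVV, ← mul_assoc, hVV]; simp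
  have h3 : star V * A * V = (star U * V)ᴴ * diagonal (fun i => (hA.1.eigenvalues i : ℂ)) *
      (star U * V) := by
    conv_lhs => rw [hA.1.eq_mul_diagonal_mul, ← hU]
    simp only [mul_assoc, star_eq_conjTranspose, conjTranspose_mul, conjTranspose_conjTranspose]
  have h4 : 0 ≤ ((star V * ((C : ℂ) • B - A) * V) j j).re :=
    (Complex.le_def.1 (h1.diag_nonneg (i := j))).1
  have h5 : ((star V * ((C : ℂ) • B - A) * V) j j).re =
      - ∑ i, hA.1.overlap hB.1 i j * hA.1.eigenvalues i := by
    rw [mul_sub, sub_mul, mul_smul_comm, smul_mul_assoc, h2, h3]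
    rw [sub_apply, smul_apply, diagonal_apply_eq, hj, mul_apply]
    simp only [mul_diagonal, conjTranspose_apply, Complex.star_def, IsHermitian.overlap,
      ← hU, ← hV]
    simp [Complex.normSq_apply]
    exact Finset.sum_congr rfl fun i _ => by ring
  rw [h5] at h4
  have h6 := (Finset.sum_eq_zero_iff_of_nonneg (s := Finset.univ) fun i _ =>
    mul_nonneg (hA.1.overlap_nonneg hB.1 i j) (hA.eigenvalues_nonneg i)).1
    (le_antisymm (by linarith) (Finset.sum_nonneg fun i _ =>
      mul_nonneg (hA.1.overlap_nonneg hB.1 i j) (hA.eigenvalues_nonneg i)))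
  exact h6 i (Finset.mem_univ i)

/-- On the support of `B`, `log (c B) = log c + log B`. -/
theorem PosSemidef.re_trace_mul_mlog_smul {A B : Matrix (Fin k) (Fin k) ℂ}
    (hA : A.PosSemidef) (hB : B.PosSemidef) {C : ℝ} (h : ((C : ℂ) • B - A).PosSemidef)
    {c : ℝ} (hc : 0 < c) :
    (trace (A * mlog ((c : ℂ) • B))).re =
      Real.log c * (trace A).re + (trace (A * mlog B)).re := by
  have e1 := hA.1.re_trace_cfc_mul_cfc hB.1 id (fun x => Real.log (c * x))
  have e2 := hA.1.re_trace_cfc_mul_cfc hB.1 id Real.log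
  have e3 := hA.1.re_trace_cfc_mul_cfc hB.1 id (fun _ => 1)
  rw [cfc_id ℝ A hA.1.isSelfAdjoint] at e1 e2 e3
  rw [cfc_const_one ℝ B hB.1.isSelfAdjoint, mul_one] at e3
  rw [hB.1.mlog_smul_eq_cfc, hB.1.mlog_eq_cfc, e1, e2, e3, Finset.mul_sum,
    ← Finset.sum_add_distrib]
  refine Finset.sum_congr rfl fun i _ => ?_
  rw [Finset.mul_sum, ← Finset.sum_add_distrib]
  refine Finset.sum_congr rfl fun j _ => ?_
  by_cases hj : hB.1.eigenvalues j = 0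
  · have := hA.overlap_mul_eq_zero hB h (i := i) hj
    simp [hj]
    right
    simpa using this
  · rw [Real.log_mul hc.ne' hj]
    simp only [id]
    ring

/-- Cauchy–Schwarz for the inner product `⟨X, Y⟩ = Tr(Xᴴ ρ Y)` with `X = 1`. -/
theorem _root_.IsDensity.sq_re_trace_le {r : Matrix (Fin k) (Fin k) ℂ} (hr : IsDensity r)
    (Y : Matrix (Fin k) (Fin k) ℂ) :
    (trace (Yᴴ * r)).re ^ 2 ≤ (trace (r * (Y * Yᴴ))).re := by
  set z := (trace (Yᴴ * r)).re with hz
  have h1 : 0 ≤ (trace ((Y - (z : ℂ) • 1)ᴴ * r * (Y - (z : ℂ) • 1))).re :=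
    (Complex.le_def.1 (hr.1.conjTranspose_mul_mul_same _).trace_nonneg).1
  have h2 : (trace (r * Y)).re = z := by
    have : trace (r * Y) = star (trace (Yᴴ * r)) := by
      rw [← trace_conjTranspose, conjTranspose_mul, conjTranspose_conjTranspose, hr.1.1.eq]
    rw [this, hz]; simp
  have h3 : trace ((Y - (z : ℂ) • 1)ᴴ * r * (Y - (z : ℂ) • 1)) =
      trace (r * (Y * Yᴴ)) - z * trace (Yᴴ * r) - z * trace (r * Y) + z * z := by
    rw [← mul_assoc, trace_mul_comm (r * Y), ← mul_assoc]
    simp [sub_mul, mul_sub, conjTranspose_sub, conjTranspose_smul, hr.2]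
    ring
  rw [h3] at h1
  simp [h2, ← hz] at h1
  nlinarith

theorem _root_.IsDensity.sq_re_trace_le' {r : Matrix (Fin k) (Fin k) ℂ} (hr : IsDensity r)
    (Y : Matrix (Fin k) (Fin k) ℂ) :
    (trace (Yᴴ * r)).re ^ 2 ≤ (trace (r * (Yᴴ * Y))).re := by
  have h2 : (trace (Yᴴ * r)).re = (trace (Yᴴᴴ * r)).re := by
    have : trace (Yᴴᴴ * r) = star (trace (Yᴴ * r)) := by
      rw [← trace_conjTranspose, conjTranspose_mul, hr.1.1.eq, trace_mul_comm]
    rw [this]; simp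
  rw [h2]
  simpa using hr.sq_re_trace_le Yᴴ

theorem re_trace_conjTranspose_mul_diagonal (W : Matrix (Fin k) (Fin k) ℂ)
    (h : Fin k → Fin k → ℝ) (d e : Fin k → ℝ) :
    (trace ((of fun i j => (h i j : ℂ) * W i j)ᴴ * (diagonal (fun i => (d i : ℂ)) * W *
      diagonal (fun j => (e j : ℂ))))).re =
      ∑ i, ∑ j, Complex.normSq (W i j) * (h i j * (d i * e j)) := by
  rw [Finset.sum_comm]
  simp only [trace, diag_apply, mul_apply (M := (of fun i j => (h i j : ℂ) * W i j)ᴴ),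
    mul_diagonal, diagonal_mul, conjTranspose_apply, Complex.re_sum, of_apply]
  refine Finset.sum_congr rfl fun i _ => Finset.sum_congr rfl fun j _ => ?_
  simp [Complex.normSq_apply]
  ring

/-- The chi-square type divergence
`∑ᵢⱼ |⟨aᵢ, bⱼ⟩|² (λᵢ - μⱼ)² / (a λᵢ + b μⱼ)` contracts under the preparation map
`p ↦ ∑ₓ pₓ ρₓ`. -/
theorem sum_overlap_mul_sq_div_le {ι : Type*} [Fintype ι] {r : ι → Matrix (Fin k) (Fin k) ℂ}
    (hr : ∀ x, IsDensity (r x)) {p q : ι → ℝ} (hp : ∀ x, 0 < p x) (hq : ∀ x, 0 < q x)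
    {A B : Matrix (Fin k) (Fin k) ℂ} (hA : A.IsHermitian) (hB : B.IsHermitian)
    (hAp : A = ∑ x, (p x : ℂ) • r x) (hBq : B = ∑ x, (q x : ℂ) • r x)
    {a b : ℝ} (ha : 0 < a) (hb : 0 < b) :
    ∑ i, ∑ j, hA.overlap hB i j * ((hA.eigenvalues i - hB.eigenvalues j) ^ 2 /
      (a * hA.eigenvalues i + b * hB.eigenvalues j)) ≤
    ∑ x, (p x - q x) ^ 2 / (a * p x + b * q x) := by
  set U := (hA.eigenvectorUnitary : Matrix (Fin k) (Fin k) ℂ) with hU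
  set V := (hB.eigenvectorUnitary : Matrix (Fin k) (Fin k) ℂ) with hV
  set l := hA.eigenvalues with hl
  set m := hB.eigenvalues with hm
  have hU1 : star U * U = 1 := Unitary.coe_star_mul_self _
  have hV1 : star V * V = 1 := Unitary.coe_star_mul_self _
  have hUU : ∀ X, star U * (U * X) = X := fun X => by rw [← mul_assoc, hU1, one_mul]
  have hVV : ∀ X, star V * (V * X) = X := fun X => by rw [← mul_assoc, hV1, one_mul]
  set h : Fin k → Fin k → ℝ := fun i j => (l i - m j) / (a * l i + b * m j) with hh
  set W := star U * V with hW
  set M : Matrix (Fin k) (Fin k) ℂ := of fun i j => (h i j : ℂ) * W i j with hM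
  set Y := U * M * star V with hY
  have eA : A = U * diagonal (fun i => (l i : ℂ)) * star U := hA.eq_mul_diagonal_mul
  have eB : B = V * diagonal (fun i => (m i : ℂ)) * star V := hB.eq_mul_diagonal_mul
  have hYH : Yᴴ = V * Mᴴ * star U := by
    simp only [hY, conjTranspose_mul, star_eq_conjTranspose, conjTranspose_conjTranspose,
      mul_assoc]
  have nM : ∀ i j, Complex.normSq (M i j) = hA.overlap hB i j * h i j ^ 2 := fun i j => by
    simp only [hM, of_apply, Complex.normSq_mul, Complex.normSq_ofReal, IsHermitian.overlap]
    ring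
  have k1 : (trace (A * (Y * Yᴴ))).re = ∑ i, ∑ j, hA.overlap hB i j * h i j ^ 2 * l i := by
    have := re_trace_diagonal_mul_conj M l (fun _ => 1)
    simp only [nM, mul_one, Complex.ofReal_one, diagonal_one] at this
    rw [← this, hYH, eA, hY]
    simp only [mul_assoc, hUU, hVV]
    rw [trace_mul_comm]
    simp only [mul_assoc, hU1, mul_one]
  have k2 : (trace (B * (Yᴴ * Y))).re = ∑ i, ∑ j, hA.overlap hB i j * h i j ^ 2 * m j := by
    have := re_trace_diagonal_mul_conj M (fun _ => 1) m
    simp only [nM, one_mul, Complex.ofReal_one, diagonal_one] at this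
    rw [← this, hYH, eB, hY]
    simp only [mul_assoc, hUU, hVV]
    rw [trace_mul_comm]
    simp only [mul_assoc, hV1, mul_one]
    rw [← mul_assoc, trace_mul_comm]
  have k3 : (trace (Yᴴ * A)).re = ∑ i, ∑ j, hA.overlap hB i j * (h i j * l i) := by
    have := re_trace_conjTranspose_mul_diagonal W h l (fun _ => 1)
    simp only [mul_one, Complex.ofReal_one, diagonal_one] at this
    refine Eq.trans ?_ this
    rw [hYH, eA, mul_assoc, mul_assoc, trace_mul_comm]
    simp only [mul_assoc, hUU, hW, hM]
  have k4 : (trace (Yᴴ * B)).re = ∑ i, ∑ j, hA.overlap hB i j * (h i j * m j) := by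
    have := re_trace_conjTranspose_mul_diagonal W h (fun _ => 1) m
    simp only [one_mul, Complex.ofReal_one, diagonal_one] at this
    refine Eq.trans ?_ this
    rw [hYH, eB, mul_assoc, mul_assoc, trace_mul_comm]
    simp only [mul_assoc, hV1, mul_one, hW, hM]
  set Q := ∑ i, ∑ j, hA.overlap hB i j * ((l i - m j) ^ 2 / (a * l i + b * m j)) with hQ
  have q1 : Q = (trace (Yᴴ * A)).re - (trace (Yᴴ * B)).re := by
    rw [k3, k4, hQ]
    simp only [← Finset.sum_sub_distrib]
    refine Finset.sum_congr rfl fun i _ => Finset.sum_congr rfl fun j _ => ?_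
    simp only [hh]
    ring
  have q2 : Q = a * (trace (A * (Y * Yᴴ))).re + b * (trace (B * (Yᴴ * Y))).re := by
    rw [k1, k2, hQ]
    simp only [Finset.mul_sum, ← Finset.sum_add_distrib]
    refine Finset.sum_congr rfl fun i _ => Finset.sum_congr rfl fun j _ => ?_
    simp only [hh]
    by_cases h0 : a * l i + b * m j = 0
    · simp [h0]
    · field_simp
  have t1 : ∀ (X : Matrix (Fin k) (Fin k) ℂ) (c : ι → ℝ),
      (trace ((∑ x, (c x : ℂ) • r x) * X)).re = ∑ x, c x * (trace (r x * X)).re := by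
    intro X c
    simp [Finset.sum_mul, trace_sum]
  have t2 : ∀ (X : Matrix (Fin k) (Fin k) ℂ) (c : ι → ℝ),
      (trace (X * (∑ x, (c x : ℂ) • r x))).re = ∑ x, c x * (trace (X * r x)).re := by
    intro X c
    simp [Finset.mul_sum, trace_sum]
  have q3 : Q = 2 * Q - Q := by ring
  rw [q3]
  nth_rewrite 1 [q1]
  rw [q2, hAp, hBq, t1, t1, t2, t2]
  simp only [Finset.mul_sum, ← Finset.sum_sub_distrib, ← Finset.sum_add_distrib]
  refine Finset.sum_le_sum fun x _ => ?_
  have s1 := (hr x).sq_re_trace_le Y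
  have s2 := (hr x).sq_re_trace_le' Y
  set z := (trace (Yᴴ * r x)).re
  have hpos : 0 < a * p x + b * q x := by have := hp x; have := hq x; positivity
  have s3 := mul_le_mul_of_nonneg_left s1 (mul_pos ha (hp x)).le
  have s4 := mul_le_mul_of_nonneg_left s2 (mul_pos hb (hq x)).le
  rw [le_div_iff₀ hpos]
  nlinarith [sq_nonneg ((p x - q x) - (a * p x + b * q x) * z)]

/-- A primitive of `(1 - u) (a - b)² / (u a + (1 - u) b)`, whose increment over `[0, 1]` is
`a log (a / b) - a + b`. -/
noncomputable def _root_.relEntPrimitive (a b u : ℝ) : ℝ :=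
  a * Real.log (u * a + (1 - u) * b) - (a - b) * u

theorem _root_.relEntPrimitive_continuousOn {a b : ℝ} (ha : 0 ≤ a) (hb : 0 ≤ b)
    (hab : b = 0 → a = 0) : ContinuousOn (relEntPrimitive a b) (Set.Icc 0 1) := by
  unfold relEntPrimitive
  rcases ha.eq_or_lt with rfl | ha'
  · simp only [zero_mul]; fun_prop
  · have hb' : 0 < b := hb.lt_of_ne fun h => ha'.ne' (hab h.symm)
    refine ContinuousOn.sub (continuousOn_const.mul (ContinuousOn.log (by fun_prop) ?_))
      (by fun_prop)
    intro u hu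
    rcases hu.1.eq_or_lt with rfl | hu0
    · simpa using hb'.ne'
    · have := mul_pos hu0 ha'
      have := mul_nonneg (sub_nonneg.2 hu.2) hb'.le
      positivity

theorem _root_.relEntPrimitive_hasDerivAt {a b : ℝ} (ha : 0 ≤ a) (hb : 0 ≤ b)
    (hab : b = 0 → a = 0) {u : ℝ} (hu : u ∈ Set.Ioo (0 : ℝ) 1) :
    HasDerivAt (relEntPrimitive a b) ((1 - u) * ((a - b) ^ 2 / (u * a + (1 - u) * b))) u := by
  unfold relEntPrimitive
  have hu1 : 0 < 1 - u := sub_pos.2 hu.2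
  rcases hb.eq_or_lt with rfl | hb'
  · simp only [hab rfl]
    simpa using hasDerivAt_const u (0 : ℝ)
  · have hpos : 0 < u * a + (1 - u) * b :=
      add_pos_of_nonneg_of_pos (mul_nonneg hu.1.le ha) (mul_pos hu1 hb')
    have h1 : HasDerivAt (fun u => u * a + (1 - u) * b) (a - b) u := by
      have := ((hasDerivAt_id u).mul_const a).add
        (((hasDerivAt_const u (1 : ℝ)).sub (hasDerivAt_id u)).mul_const b)
      exact this.congr_deriv (by ring)
    have h2 := ((h1.log hpos.ne').const_mul a).sub ((hasDerivAt_id u).const_mul (a - b))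
    refine h2.congr_deriv ?_
    set d := u * a + (1 - u) * b with hd
    field_simp
    rw [hd]
    ring

/-- Monotonicity of the relative entropy under the preparation map `p ↦ ∑ₓ pₓ ρₓ`. -/
theorem re_trace_mul_mlog_sub_le {ι : Type*} [Fintype ι] {r : ι → Matrix (Fin k) (Fin k) ℂ}
    (hr : ∀ x, IsDensity (r x)) {p q : ι → ℝ} (hp : ∀ x, 0 < p x) (hq : ∀ x, 0 < q x)
    {A B : Matrix (Fin k) (Fin k) ℂ} (hA : A.PosSemidef) (hB : B.PosSemidef)
    (hAp : A = ∑ x, (p x : ℂ) • r x) (hBq : B = ∑ x, (q x : ℂ) • r x)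
    {C : ℝ} (h : ((C : ℂ) • B - A).PosSemidef) :
    (trace (A * mlog A)).re - (trace (A * mlog B)).re ≤
      ∑ x, p x * (Real.log (p x) - Real.log (q x)) := by
  set l := hA.1.eigenvalues with hl
  set m := hB.1.eigenvalues with hm
  set w := hA.1.overlap hB.1 with hw
  have hl0 : ∀ i, 0 ≤ l i := hA.eigenvalues_nonneg
  have hm0 : ∀ j, 0 ≤ m j := hB.eigenvalues_nonneg
  have hz : ∀ i j, w i j = 0 ∨ (m j = 0 → l i = 0) := by
    intro i j
    by_cases hj : m j = 0
    · rcases mul_eq_zero.1 (hA.overlap_mul_eq_zero hB h (i := i) hj) with h0 | h0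
      · exact .inl h0
      · exact .inr fun _ => h0
    · exact .inr fun h' => absurd h' hj
  set G : ℝ → ℝ := fun u => ∑ x, relEntPrimitive (p x) (q x) u -
    ∑ i, ∑ j, w i j * relEntPrimitive (l i) (m j) u with hG
  have hpq : ∀ x, q x = 0 → p x = 0 := fun x hx => absurd hx (hq x).ne'
  have hcont : ContinuousOn G (Set.Icc 0 1) := by
    refine ContinuousOn.sub (continuousOn_finsetSum _ fun x _ =>
      relEntPrimitive_continuousOn (hp x).le (hq x).le (hpq x)) ?_
    refine continuousOn_finsetSum _ fun i _ => continuousOn_finsetSum _ fun j _ => ?_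
    rcases hz i j with h0 | h0
    · simp only [h0, zero_mul]; fun_prop
    · exact continuousOn_const.mul (relEntPrimitive_continuousOn (hl0 i) (hm0 j) h0)
  have hderiv : ∀ u ∈ Set.Ioo (0 : ℝ) 1, HasDerivAt G
      ((1 - u) * (∑ x, (p x - q x) ^ 2 / (u * p x + (1 - u) * q x) -
        ∑ i, ∑ j, w i j * ((l i - m j) ^ 2 / (u * l i + (1 - u) * m j)))) u := by
    intro u hu
    rw [mul_sub, Finset.mul_sum, Finset.mul_sum]
    simp only [Finset.mul_sum]
    refine HasDerivAt.sub (HasDerivAt.fun_sum fun x _ =>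
      relEntPrimitive_hasDerivAt (hp x).le (hq x).le (hpq x) hu) ?_
    refine HasDerivAt.fun_sum fun i _ => HasDerivAt.fun_sum fun j _ => ?_
    rcases hz i j with h0 | h0
    · simpa only [h0, zero_mul, mul_zero] using hasDerivAt_const u (0 : ℝ)
    · rw [mul_left_comm]
      exact (relEntPrimitive_hasDerivAt (hl0 i) (hm0 j) h0 hu).const_mul _
  have hmono : MonotoneOn G (Set.Icc 0 1) := by
    refine monotoneOn_of_deriv_nonneg (convex_Icc 0 1) hcont ?_ ?_
    · rw [interior_Icc]
      exact fun u hu => (hderiv u hu).differentiableAt.differentiableWithinAt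
    · rw [interior_Icc]
      intro u hu
      rw [(hderiv u hu).deriv]
      exact mul_nonneg (sub_nonneg.2 hu.2.le) (sub_nonneg.2
        (sum_overlap_mul_sq_div_le hr hp hq hA.1 hB.1 hAp hBq hu.1 (sub_pos.2 hu.2)))
  have hle : G 0 ≤ G 1 := hmono (by simp) (by simp) zero_le_one
  have e1 := hA.1.re_trace_cfc_mul_cfc hB.1 id Real.log
  have e2 := hA.1.re_trace_cfc_mul_cfc hB.1 (fun x => x * Real.log x) (fun _ => 1)
  have e3 := hA.1.re_trace_cfc_mul_cfc hB.1 id (fun _ => 1)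
  have e4 := hA.1.re_trace_cfc_mul_cfc hB.1 (fun _ => 1) id
  have hfin : ∀ f : ℝ → ℝ, ContinuousOn f (spectrum ℝ A) :=
    fun f => Matrix.finite_real_spectrum.continuousOn f
  have hAlog : cfc (fun x => x * Real.log x) A = A * mlog A := by
    rw [cfc_mul (fun x : ℝ => x) Real.log A (hfin _) (hfin _), cfc_id' ℝ A hA.1.isSelfAdjoint,
      hA.1.mlog_eq_cfc]
  rw [cfc_id ℝ A hA.1.isSelfAdjoint, ← hB.1.mlog_eq_cfc] at e1
  rw [cfc_const_one ℝ B hB.1.isSelfAdjoint, mul_one, hAlog] at e2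
  rw [cfc_const_one ℝ B hB.1.isSelfAdjoint, mul_one, cfc_id ℝ A hA.1.isSelfAdjoint] at e3
  rw [cfc_const_one ℝ A hA.1.isSelfAdjoint, one_mul, cfc_id ℝ B hB.1.isSelfAdjoint] at e4
  have t : ∀ c : ι → ℝ, (trace (∑ x, (c x : ℂ) • r x)).re = ∑ x, c x := by
    intro c
    simp [trace_sum, (hr _).2]
  have d1 : (trace A).re = ∑ x, p x := by rw [hAp, t]
  have d2 : (trace B).re = ∑ x, q x := by rw [hBq, t]
  rw [d1] at e3
  rw [d2] at e4
  simp only [id, mul_one, one_mul, ← hw, ← hl, ← hm] at e1 e2 e3 e4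
  simp only [hG, relEntPrimitive, zero_mul, one_mul, sub_zero, sub_self, add_zero, zero_add,
    mul_zero, mul_one, mul_sub, Finset.sum_sub_distrib, Finset.sum_const_zero] at hle
  rw [e1, e2]
  simp only [mul_sub, Finset.sum_sub_distrib]
  linarith

theorem posSemidef_sum_smul {ι : Type*} [Fintype ι] {r : ι → Matrix (Fin k) (Fin k) ℂ}
    (hr : ∀ x, (r x).PosSemidef) {c : ι → ℝ} (hc : ∀ x, 0 ≤ c x) :
    (∑ x, (c x : ℂ) • r x).PosSemidef :=
  posSemidef_sum _ fun x _ => (hr x).smul (by exact_mod_cast hc x)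

/-- Two mixtures with positive weights are mutually absolutely continuous. -/
theorem exists_posSemidef_smul_sum_sub_sum {ι : Type*} [Fintype ι]
    {r : ι → Matrix (Fin k) (Fin k) ℂ} (hr : ∀ x, (r x).PosSemidef) {p q : ι → ℝ}
    (hp : ∀ x, 0 ≤ p x) (hq : ∀ x, 0 < q x) :
    ∃ C : ℝ, ((C : ℂ) • (∑ x, (q x : ℂ) • r x) - ∑ x, (p x : ℂ) • r x).PosSemidef := by
  refine ⟨∑ x, p x / q x, ?_⟩
  have h : ((∑ x, p x / q x : ℝ) : ℂ) • (∑ x, (q x : ℂ) • r x) - ∑ x, (p x : ℂ) • r x =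
      ∑ x, (((∑ y, p y / q y) * q x - p x : ℝ) : ℂ) • r x := by
    rw [Finset.smul_sum, ← Finset.sum_sub_distrib]
    refine Finset.sum_congr rfl fun x _ => ?_
    rw [smul_smul, ← sub_smul]
    push_cast
    rfl
  rw [h]
  refine posSemidef_sum_smul hr fun x => sub_nonneg.2 ?_
  rw [← div_le_iff₀ (hq x)]
  exact Finset.single_le_sum (f := fun y => p y / q y)
    (fun y _ => div_nonneg (hp y) (hq y).le) (Finset.mem_univ x)

end Matrix

section BlahutArimoto

variable {n m : ℕ} {ρ : Fin n → Matrix (Fin m) (Fin m) ℂ} {s : Fin n → ℝ} {lam : ℝ}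
  {p q : Fin n → ℝ}

theorem rBA_pos (x : Fin n) : 0 < rBA ρ s lam p x := Real.exp_pos _

theorem sum_rBA_pos [Nonempty (Fin n)] : 0 < ∑ x, rBA ρ s lam p x :=
  Finset.sum_pos (fun x _ => rBA_pos x) Finset.univ_nonempty

theorem baStep_pos [Nonempty (Fin n)] (x : Fin n) : 0 < baStep ρ s lam p x :=
  div_pos (rBA_pos x) sum_rBA_pos

theorem sum_baStep [Nonempty (Fin n)] : ∑ x, baStep ρ s lam p x = 1 := by
  simp only [baStep, ← Finset.sum_div]
  exact div_self sum_rBA_pos.ne'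

theorem exists_posSemidef_smul_sum_sub (hρ : ∀ x, IsDensity (ρ x)) (hq : ∀ x, 0 < q x)
    (x : Fin n) : ∃ C : ℝ, ((C : ℂ) • (∑ y, (q y : ℂ) • ρ y) - ρ x).PosSemidef := by
  obtain ⟨C, hC⟩ := exists_posSemidef_smul_sum_sub_sum (fun y => (hρ y).1)
    (p := Pi.single x 1) (fun y => by by_cases h : y = x <;> simp [h]) hq
  refine ⟨C, ?_⟩
  convert hC using 2
  rw [Finset.sum_eq_single x] <;> simp +contextual

theorem re_trace_mul_mlog_smul_self {r : Matrix (Fin m) (Fin m) ℂ} (hr : IsDensity r) {c : ℝ}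
    (hc : 0 < c) :
    (trace (r * mlog ((c : ℂ) • r))).re = Real.log c + (trace (r * mlog r)).re := by
  have h := hr.1.re_trace_mul_mlog_smul hr.1 (C := 1) (by simpa using PosSemidef.zero) hc
  simpa [hr.2] using h

theorem log_rBA (hρ : ∀ x, IsDensity (ρ x)) (hq : ∀ x, 0 < q x) (x : Fin n) :
    Real.log (rBA ρ s lam q x) = Real.log (q x) + (trace (ρ x * mlog (ρ x))).re -
      (trace (ρ x * mlog (∑ y, (q y : ℂ) • ρ y))).re - lam * s x := by
  rw [rBA, Real.log_exp, mul_sub, trace_sub, Complex.sub_re,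
    re_trace_mul_mlog_smul_self (hρ x) (hq x)]

theorem fBA_eq (hρ : ∀ x, IsDensity (ρ x)) (hp : ∀ x, 0 < p x) (hq : ∀ x, 0 < q x) :
    fBA ρ s lam p q = ∑ x, p x * (Real.log (rBA ρ s lam q x) - Real.log (p x)) := by
  rw [fBA, Finset.mul_sum, ← Finset.sum_sub_distrib]
  refine Finset.sum_congr rfl fun x _ => ?_
  obtain ⟨C, hC⟩ := exists_posSemidef_smul_sum_sub hρ hq x
  have h := (hρ x).1.re_trace_mul_mlog_smul
    (posSemidef_sum_smul (fun y => (hρ y).1) fun y => (hq y).le) hC (hp x)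
  rw [log_rBA hρ hq, smul_mul_assoc, trace_smul, smul_eq_mul, Complex.re_ofReal_mul, mul_sub,
    trace_sub, Complex.sub_re, h, re_trace_mul_mlog_smul_self (hρ x) (hq x), (hρ x).2]
  simp only [Complex.one_re]
  ring

theorem fBA_le_fBA_self (hρ : ∀ x, IsDensity (ρ x)) (hp : ∀ x, 0 < p x) (hq : ∀ x, 0 < q x) :
    fBA ρ s lam p q ≤ fBA ρ s lam p p := by
  obtain ⟨C, hC⟩ :=
    exists_posSemidef_smul_sum_sub_sum (fun x => (hρ x).1) (fun x => (hp x).le) hq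
  have h := re_trace_mul_mlog_sub_le hρ hp hq
    (posSemidef_sum_smul (fun y => (hρ y).1) fun y => (hp y).le)
    (posSemidef_sum_smul (fun y => (hρ y).1) fun y => (hq y).le) rfl rfl hC
  have t : ∀ X : Matrix (Fin m) (Fin m) ℂ, (trace ((∑ x, (p x : ℂ) • ρ x) * X)).re =
      ∑ x, p x * (trace (ρ x * X)).re := by
    intro X
    simp [Finset.sum_mul, trace_sum]
  rw [t, t] at h
  rw [fBA_eq hρ hp hq, fBA_eq hρ hp hp]
  simp only [log_rBA hρ hq, log_rBA hρ hp]
  simp only [mul_sub, mul_add, Finset.sum_sub_distrib, Finset.sum_add_distrib] at h ⊢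
  linarith

/-- Gibbs' inequality. -/
theorem sum_mul_log_sub_log_le {ι : Type*} [Fintype ι] {p q : ι → ℝ} (hp : ∀ x, 0 < p x)
    (hq : ∀ x, 0 < q x) :
    ∑ x, p x * (Real.log (q x) - Real.log (p x)) ≤ ∑ x, q x - ∑ x, p x := by
  rw [← Finset.sum_sub_distrib]
  refine Finset.sum_le_sum fun x _ => ?_
  rw [← Real.log_div (hq x).ne' (hp x).ne']
  refine (mul_le_mul_of_nonneg_left
    (Real.log_le_sub_one_of_pos (div_pos (hq x) (hp x))) (hp x).le).trans_eq ?_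
  have := (hp x).ne'
  field_simp

theorem fBA_le_fBA_baStep [Nonempty (Fin n)] (hρ : ∀ x, IsDensity (ρ x)) (hp : ∀ x, 0 < p x)
    (hp1 : ∑ x, p x = 1) (hq : ∀ x, 0 < q x) :
    fBA ρ s lam p q ≤ fBA ρ s lam (baStep ρ s lam q) q := by
  have hr : ∀ x, Real.log (rBA ρ s lam q x) =
      Real.log (baStep ρ s lam q x) + Real.log (∑ y, rBA ρ s lam q y) := fun x => by
    rw [baStep, Real.log_div (rBA_pos x).ne' sum_rBA_pos.ne', sub_add_cancel]
  have h := sum_mul_log_sub_log_le (q := baStep ρ s lam q) hp baStep_pos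
  rw [sum_baStep, hp1] at h
  rw [fBA_eq hρ hp hq, fBA_eq hρ baStep_pos hq]
  simp only [hr, add_sub_right_comm, sub_self, zero_add, mul_add, Finset.sum_add_distrib,
    ← Finset.sum_mul, sum_baStep, hp1]
  linarith

theorem baSeq_pos [Nonempty (Fin n)] (hp : ∀ x, 0 < p x) (t : ℕ) (x : Fin n) :
    0 < baSeq ρ s lam p t x := by
  cases t with
  | zero => exact hp x
  | succ t => exact baStep_pos x

end BlahutArimoto

/-- `f_λ(p^{t+1}, p^t)` is non-decreasing in `t` along the BA
iteration, via the chain `f_λ(p^{t+1},p^t) ≥ f_λ(p^t,p^t) ≥ f_λ(p^t,p^{t-1})`. -/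
theorem stmt_13 {n m : ℕ} (lam : ℝ) (hlam : 0 ≤ lam)
    (s : Fin n → ℝ) (hs : ∀ x, 0 ≤ s x)
    (ρ : Fin n → Matrix (Fin m) (Fin m) ℂ) (hρ : ∀ x, IsDensity (ρ x))
    (p0 : Fin n → ℝ) (hp0 : IsDist p0) (hp0pos : ∀ x, 0 < p0 x) :
    ∀ t : ℕ,
      fBA ρ s lam (baSeq ρ s lam p0 (t + 1)) (baSeq ρ s lam p0 t) ≤
        fBA ρ s lam (baSeq ρ s lam p0 (t + 1)) (baSeq ρ s lam p0 (t + 1)) ∧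
      fBA ρ s lam (baSeq ρ s lam p0 (t + 1)) (baSeq ρ s lam p0 (t + 1)) ≤
        fBA ρ s lam (baSeq ρ s lam p0 (t + 2)) (baSeq ρ s lam p0 (t + 1)) := by
  intro t
  have : Nonempty (Fin n) := by
    by_contra h
    rw [not_nonempty_iff] at h
    simpa using hp0.2
  exact ⟨fBA_le_fBA_self hρ (baSeq_pos hp0pos _) (baSeq_pos hp0pos _),
    fBA_le_fBA_baStep hρ (baSeq_pos hp0pos _) sum_baStep (baSeq_pos hp0pos _)⟩
end

section
/- Let (ρ_x)_{x∈X} be a family of m×m density matrices and let p, q be probability distributions on X with supp(Σ_x p_x ρ_x) ⊆ supp(Σ_x q_x ρ_x). Then D(Σ_x p_x ρ_x ‖ Σ_x q_x ρ_x) ≥ (1/2) Σ_{i,j} (p_i − q_i)(p_j − q_j) Tr(ρ_i ρ_j) = (1/2) dᵀMd, where d = p − q and M_{ij} = Tr(ρ_i ρ_j). -/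
open Matrix Finset Filter ComplexOrder

/-- Scalar form of the Klein inequality with a quadratic remainder on `[0, 1]`. -/
lemma half_sq_sub_le_mul_log_sub {a b : ℝ} (ha : 0 ≤ a) (ha1 : a ≤ 1) (hb : 0 < b) (hb1 : b ≤ 1) :
    (a - b) ^ 2 / 2 ≤ a * Real.log a - a * Real.log b - a + b := by
  rcases ha.eq_or_lt with rfl | ha
  · simp
    nlinarith
  set g : ℝ → ℝ := fun t => t - a * Real.log t - (a - t) ^ 2 / 2 with hg
  have hd : ∀ t : ℝ, 0 < t → HasDerivAt g ((t - a) * (1 / t - 1)) t := by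
    intro t ht
    have h := ((hasDerivAt_id t).sub ((Real.hasDerivAt_log ht.ne').const_mul a)).sub
      ((((hasDerivAt_id t).const_sub a).pow 2).div_const 2)
    refine h.congr_deriv ?_
    simp only [id]
    field_simp
    ring
  have hinv : ∀ t : ℝ, 0 < t → t ≤ 1 → 0 ≤ 1 / t - 1 := fun t ht ht1 => by
    rw [sub_nonneg]; exact (one_le_div ht).2 ht1
  suffices h : g a ≤ g b by
    simp only [hg] at h
    nlinarith
  rcases le_total a b with hab | hab
  · refine monotoneOn_of_deriv_nonneg (convex_Icc a b) ?_ ?_ ?_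
      (Set.left_mem_Icc.2 hab) (Set.right_mem_Icc.2 hab) hab
    · exact fun t ht => (hd t (ha.trans_le ht.1)).continuousAt.continuousWithinAt
    · intro t ht
      rw [interior_Icc] at ht
      exact (hd t (ha.trans ht.1)).differentiableAt.differentiableWithinAt
    · intro t ht
      rw [interior_Icc] at ht
      rw [(hd t (ha.trans ht.1)).deriv]
      exact mul_nonneg (sub_nonneg.2 ht.1.le) (hinv t (ha.trans ht.1) (ht.2.le.trans hb1))
  · refine antitoneOn_of_deriv_nonpos (convex_Icc b a) ?_ ?_ ?_
      (Set.left_mem_Icc.2 hab) (Set.right_mem_Icc.2 hab) hab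
    · exact fun t ht => (hd t (hb.trans_le ht.1)).continuousAt.continuousWithinAt
    · intro t ht
      rw [interior_Icc] at ht
      exact (hd t (hb.trans ht.1)).differentiableAt.differentiableWithinAt
    · intro t ht
      rw [interior_Icc] at ht
      rw [(hd t (hb.trans ht.1)).deriv]
      exact mul_nonpos_of_nonpos_of_nonneg (sub_nonpos.2 ht.2.le)
        (hinv t (hb.trans ht.1) (ht.2.le.trans ha1))

/-- The trace of a product of two matrices diagonalized by unitaries `U` and `V`. -/
lemma trace_conj_diagonal_mul_conj_diagonal {m : ℕ} (U V : Matrix (Fin m) (Fin m) ℂ)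
    (f g : Fin m → ℝ) :
    ((U * diagonal (fun i => (f i : ℂ)) * star U) *
      (V * diagonal (fun i => (g i : ℂ)) * star V)).trace.re =
      ∑ i, ∑ j, f i * g j * Complex.normSq ((star U * V) i j) := by
  have h : ((U * diagonal (fun i => (f i : ℂ)) * star U) *
      (V * diagonal (fun i => (g i : ℂ)) * star V)).trace =
      (diagonal (fun i => (f i : ℂ)) * (star U * V) *
        diagonal (fun i => (g i : ℂ)) * star (star U * V)).trace := by
    rw [star_mul, star_star]
    simp only [Matrix.mul_assoc]
    rw [trace_mul_comm U]
    simp only [Matrix.mul_assoc]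
  rw [h, Matrix.trace, Complex.re_sum]
  refine Finset.sum_congr rfl fun i _ => ?_
  rw [diag_apply, Matrix.mul_apply, Complex.re_sum]
  refine Finset.sum_congr rfl fun j _ => ?_
  rw [mul_diagonal, diagonal_mul, star_apply]
  simp only [Complex.normSq_apply, Complex.mul_re, Complex.mul_im, Complex.ofReal_re,
    Complex.ofReal_im, RCLike.star_def, Complex.conj_re, Complex.conj_im]
  ring

lemma IsDensity.eigenvalues_le_one {m : ℕ} {A : Matrix (Fin m) (Fin m) ℂ} (h : IsDensity A)
    (i : Fin m) : h.1.isHermitian.eigenvalues i ≤ 1 := by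
  have ht : ∑ j, h.1.isHermitian.eigenvalues j = 1 := by
    have := h.2.symm.trans h.1.isHermitian.trace_eq_sum_eigenvalues
    exact Complex.ofReal_injective (by push_cast; exact this.symm)
  rw [← ht]
  exact Finset.single_le_sum (fun j _ => h.1.eigenvalues_nonneg j) (Finset.mem_univ i)

lemma isDensity_sum_smul {n m : ℕ} {ρ : Fin n → Matrix (Fin m) (Fin m) ℂ}
    (hρ : ∀ x, IsDensity (ρ x)) {p : Fin n → ℝ} (hp : IsDist p) :
    IsDensity (∑ x, (p x : ℂ) • ρ x) := by
  refine ⟨posSemidef_sum _ fun x _ => (hρ x).1.smul (by exact_mod_cast hp.1 x), ?_⟩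
  simp only [trace_sum, trace_smul, (hρ _).2, smul_eq_mul, mul_one]
  exact_mod_cast hp.2

/-- Relative entropy dominates half the squared Hilbert–Schmidt distance. -/
theorem half_trace_sq_sub_le_qRelEnt {m : ℕ} {A B : Matrix (Fin m) (Fin m) ℂ}
    (hA : IsDensity A) (hB : IsDensity B) (hAB : SuppLE A B) :
    (1 / 2) * ((A - B) * (A - B)).trace.re ≤ qRelEnt A B := by
  have hA' := hA.1.isHermitian
  have hB' := hB.1.isHermitian
  set a := hA'.eigenvalues
  set b := hB'.eigenvalues
  set U : Matrix (Fin m) (Fin m) ℂ := ↑hA'.eigenvectorUnitary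
  set V : Matrix (Fin m) (Fin m) ℂ := ↑hB'.eigenvectorUnitary
  have hUU : U * star U = 1 := Unitary.coe_mul_star_self _
  have hUU' : star U * U = 1 := Unitary.coe_star_mul_self _
  have hVV : V * star V = 1 := Unitary.coe_mul_star_self _
  have hVV' : star V * V = 1 := Unitary.coe_star_mul_self _
  have specA : A = U * diagonal (fun i => (a i : ℂ)) * star U := by
    conv_lhs => rw [hA'.spectral_theorem]
    rfl
  have specB : B = V * diagonal (fun i => (b i : ℂ)) * star V := by
    conv_lhs => rw [hB'.spectral_theorem]
    rfl
  have logA : mlog A = U * diagonal (fun i => (Real.log (a i) : ℂ)) * star U := dif_pos hA'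
  have logB : mlog B = V * diagonal (fun i => (Real.log (b i) : ℂ)) * star V := dif_pos hB'
  have conj_mul : ∀ (W : Matrix (Fin m) (Fin m) ℂ) (f g : Fin m → ℝ), star W * W = 1 →
      (W * diagonal (fun i => (f i : ℂ)) * star W) * (W * diagonal (fun i => (g i : ℂ)) * star W)
        = W * diagonal (fun i => ((f i * g i : ℝ) : ℂ)) * star W := by
    intro W f g hW
    calc _ = W * diagonal (fun i => (f i : ℂ)) * (star W * W) * diagonal (fun i => (g i : ℂ))
          * star W := by simp only [Matrix.mul_assoc]
      _ = _ := by
        rw [hW, Matrix.mul_one, Matrix.mul_assoc W, diagonal_mul_diagonal]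
        simp only [Complex.ofReal_mul]
  set w : Fin m → Fin m → ℝ := fun i j => Complex.normSq ((star U * V) i j) with hw
  have trU : ∀ f : Fin m → ℝ, (U * diagonal (fun i => (f i : ℂ)) * star U).trace.re =
      ∑ i, ∑ j, f i * w i j := by
    intro f
    have := trace_conj_diagonal_mul_conj_diagonal U V f 1
    simpa [hVV] using this
  have trV : ∀ g : Fin m → ℝ, (V * diagonal (fun i => (g i : ℂ)) * star V).trace.re =
      ∑ i, ∑ j, g j * w i j := by
    intro g
    have := trace_conj_diagonal_mul_conj_diagonal U V 1 g
    simpa [hUU] using this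
  have tA : ∑ i, ∑ j, a i * w i j = 1 := by
    rw [← trU, ← specA, hA.2, Complex.one_re]
  have tB : ∑ i, ∑ j, b j * w i j = 1 := by
    rw [← trV, ← specB, hB.2, Complex.one_re]
  have tAA : (A * A).trace.re = ∑ i, ∑ j, a i * a i * w i j := by
    rw [← trU (fun i => a i * a i), ← conj_mul U a a hUU', ← specA]
  have tBB : (B * B).trace.re = ∑ i, ∑ j, b j * b j * w i j := by
    rw [← trV (fun i => b i * b i), ← conj_mul V b b hVV', ← specB]
  have tAB : (A * B).trace.re = ∑ i, ∑ j, a i * b j * w i j := by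
    rw [← trace_conj_diagonal_mul_conj_diagonal U V a b, ← specA, ← specB]
  have tAlogA : (A * mlog A).trace.re = ∑ i, ∑ j, a i * Real.log (a i) * w i j := by
    rw [← trU (fun i => a i * Real.log (a i)), ← conj_mul U a (fun i => Real.log (a i)) hUU',
      ← specA, ← logA]
  have tAlogB : (A * mlog B).trace.re = ∑ i, ∑ j, a i * Real.log (b j) * w i j := by
    rw [← trace_conj_diagonal_mul_conj_diagonal U V a (fun j => Real.log (b j)), ← specA, ← logB]
  have hker : ∀ i j, b j = 0 → a i = 0 ∨ w i j = 0 := by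
    intro i j hj
    have hBv : B *ᵥ V.col j = 0 := by
      have hBV : B * V = V * diagonal (fun i => (b i : ℂ)) := by
        rw [specB, Matrix.mul_assoc _ (star V), hVV', Matrix.mul_one]
      ext k
      have := congrFun (congrFun hBV k) j
      rw [mul_diagonal, hj, Complex.ofReal_zero, mul_zero] at this
      simpa [Matrix.mul_apply, mulVec, dotProduct] using this
    have hAv := hAB _ hBv
    have hAV : diagonal (fun i => (a i : ℂ)) * (star U * V) = star U * (A * V) := by
      have hUA : star U * A = diagonal (fun i => (a i : ℂ)) * star U := by
        conv_lhs => rw [specA]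
        rw [← Matrix.mul_assoc, ← Matrix.mul_assoc, hUU', Matrix.one_mul]
      rw [← Matrix.mul_assoc, ← hUA, Matrix.mul_assoc]
    have hcol : ∀ k, (A * V) k j = 0 := fun k => by
      simpa [Matrix.mul_apply, mulVec, dotProduct] using congrFun hAv k
    have h := congrFun (congrFun hAV i) j
    rw [diagonal_mul, Matrix.mul_apply (N := A * V)] at h
    simp only [hcol, mul_zero, Finset.sum_const_zero] at h
    rcases mul_eq_zero.1 h with h | h
    · exact Or.inl (by exact_mod_cast h)
    · exact Or.inr (by simp [hw, h])
  have main : ∑ i, ∑ j, (a i - b j) ^ 2 / 2 * w i j ≤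
      ∑ i, ∑ j, (a i * Real.log (a i) - a i * Real.log (b j) - a i + b j) * w i j := by
    refine Finset.sum_le_sum fun i _ => Finset.sum_le_sum fun j _ => ?_
    have hb0 : 0 ≤ b j := hB.1.eigenvalues_nonneg j
    rcases hb0.eq_or_lt with hj | hj
    · rcases hker i j hj.symm with h | h
      · simp [h, ← hj]
      · simp [h]
    · exact mul_le_mul_of_nonneg_right (half_sq_sub_le_mul_log_sub (hA.1.eigenvalues_nonneg i)
        (hA.eigenvalues_le_one i) hj (hB.eigenvalues_le_one j)) (Complex.normSq_nonneg _)
  have hl : ∑ i, ∑ j, (a i - b j) ^ 2 / 2 * w i j =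
      (1 / 2) * (∑ i, ∑ j, a i * a i * w i j - 2 * ∑ i, ∑ j, a i * b j * w i j
        + ∑ i, ∑ j, b j * b j * w i j) := by
    simp only [Finset.mul_sum, ← Finset.sum_sub_distrib, ← Finset.sum_add_distrib]
    exact Finset.sum_congr rfl fun i _ => Finset.sum_congr rfl fun j _ => by ring
  have hr : ∑ i, ∑ j, (a i * Real.log (a i) - a i * Real.log (b j) - a i + b j) * w i j =
      ∑ i, ∑ j, a i * Real.log (a i) * w i j - ∑ i, ∑ j, a i * Real.log (b j) * w i j
        - ∑ i, ∑ j, a i * w i j + ∑ i, ∑ j, b j * w i j := by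
    simp only [← Finset.sum_sub_distrib, ← Finset.sum_add_distrib]
    exact Finset.sum_congr rfl fun i _ => Finset.sum_congr rfl fun j _ => by ring
  have hq : qRelEnt A B = (A * mlog A).trace.re - (A * mlog B).trace.re := by
    rw [qRelEnt, Matrix.mul_sub, trace_sub, Complex.sub_re]
  have hs : ((A - B) * (A - B)).trace.re =
      (A * A).trace.re - 2 * (A * B).trace.re + (B * B).trace.re := by
    simp only [Matrix.mul_sub, Matrix.sub_mul, trace_sub, Complex.sub_re, trace_mul_comm B A]
    ring
  rw [hl, hr, tA, tB, ← tAA, ← tAB, ← tBB, ← tAlogA, ← tAlogB] at main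
  rw [hq, hs]
  linarith

/-- `D(Σ_x p_x ρ_x ‖ Σ_x q_x ρ_x) ≥ (1/2) dᵀMd` where `d = p − q`
and `M_{ij} = Tr(ρ_i ρ_j)`. -/
theorem stmt_17 {n m : ℕ} (ρ : Fin n → Matrix (Fin m) (Fin m) ℂ)
    (hρ : ∀ x, IsDensity (ρ x))
    (p q : Fin n → ℝ) (hp : IsDist p) (hq : IsDist q)
    (hsupp : SuppLE (∑ x, (p x : ℂ) • ρ x) (∑ x, (q x : ℂ) • ρ x)) :
    (1 / 2) * ∑ i, ∑ j, (p i - q i) * (p j - q j) * (Matrix.trace (ρ i * ρ j)).re ≤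
      qRelEnt (∑ x, (p x : ℂ) • ρ x) (∑ x, (q x : ℂ) • ρ x) := by
  have hd : ∑ x, (p x : ℂ) • ρ x - ∑ x, (q x : ℂ) • ρ x = ∑ x, ((p x - q x : ℝ) : ℂ) • ρ x := by
    simp only [← Finset.sum_sub_distrib, ← sub_smul, Complex.ofReal_sub]
  convert half_trace_sq_sub_le_qRelEnt (isDensity_sum_smul hρ hp) (isDensity_sum_smul hρ hq) hsupp
    using 2
  rw [hd, Finset.sum_mul_sum, trace_sum, Complex.re_sum]
  refine Finset.sum_congr rfl fun i _ => ?_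
  rw [trace_sum, Complex.re_sum]
  refine Finset.sum_congr rfl fun j _ => ?_
  rw [smul_mul_smul_comm, trace_smul, smul_eq_mul, ← Complex.ofReal_mul, Complex.re_ofReal_mul]
end
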